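/- Let 𝒳, 𝒴, 𝒰, 𝒲, 𝒱₀, 𝒱₁ be nonempty finite types, let μ₀ be a probability mass function on 𝒳 (law of the initial state X₀), ηW a probability mass function on 𝒲 (law of the disturbance W₀), and ν₀, ν₁ probability mass functions on 𝒱₀, 𝒱₁ (laws of the measurement noises V₀, V₁), all mutually independent. Let h₀ : 𝒳 → 𝒱₀ → 𝒴 and h₁ : 𝒳 → 𝒱₁ → 𝒴 be observation functions and f : 𝒳 → 𝒰 → 𝒲 → 𝒳 a state transition function. For a control policy g : 𝒴 → 𝒰, define the closed-loop joint distribution of (X₀, V₀, W₀, V₁) as the product μ₀ ⊗ ν₀ ⊗ ηW ⊗ ν₁, and set Y₀ := h₀ X₀ V₀, U₀ := g Y₀, X₁ := f X₀ U₀ W₀, Y₁ := h₁ X₁ V₁. Then the conditional distribution of the state given the observation history and applied action is independent of the control policy: for any two policies g, g' : 𝒴 → 𝒰 and any y₀ ∈ 𝒴, y₁ ∈ 𝒴, x₁ ∈ 𝒳 such that g y₀ = g' y₀ and the event {Y₀ = y₀, Y₁ = y₁} has positive probability under both closed-loop distributions, the conditional probabilities coincide: P^g(X₁ = x₁ | Y₀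 = y₀, Y₁ = y₁) = P^{g'}(X₁ = x₁ | Y₀ = y₀, Y₁ = y₁). -/

import Mathlib

open Finset

/-- The closed-loop probability of the event `{X₁ = x₁, Y₀ = y₀, Y₁ = y₁}`
under policy `g`, where the primitive random variables `(X₀, V₀, W₀, V₁)` are
independent with laws `μ₀, ν₀, ηW, ν₁`, and `Y₀ = h₀ X₀ V₀`, `U₀ = g Y₀`,
`X₁ = f X₀ U₀ W₀`, `Y₁ = h₁ X₁ V₁`. -/
def jointProb {𝒳 𝒴 𝒰 𝒲 𝒱₀ 𝒱₁ : Type*}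
    [Fintype 𝒳] [Fintype 𝒲] [Fintype 𝒱₀] [Fintype 𝒱₁]
    [DecidableEq 𝒳] [DecidableEq 𝒴]
    (μ₀ : 𝒳 → ℝ) (ηW : 𝒲 → ℝ) (ν₀ : 𝒱₀ → ℝ) (ν₁ : 𝒱₁ → ℝ)
    (h₀ : 𝒳 → 𝒱₀ → 𝒴) (h₁ : 𝒳 → 𝒱₁ → 𝒴) (f : 𝒳 → 𝒰 → 𝒲 → 𝒳)
    (g : 𝒴 → 𝒰) (y₀ y₁ : 𝒴) (x₁ : 𝒳) : ℝ :=
  ∑ x₀ : 𝒳, ∑ v₀ : 𝒱₀, ∑ w : 𝒲, ∑ v₁ : 𝒱₁,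
    if h₀ x₀ v₀ = y₀ ∧ f x₀ (g (h₀ x₀ v₀)) w = x₁ ∧
        h₁ (f x₀ (g (h₀ x₀ v₀)) w) v₁ = y₁ then
      μ₀ x₀ * ν₀ v₀ * ηW w * ν₁ v₁
    else 0

/-- The closed-loop probability of the event `{Y₀ = y₀, Y₁ = y₁}` under
policy `g`. -/
def margProb {𝒳 𝒴 𝒰 𝒲 𝒱₀ 𝒱₁ : Type*}
    [Fintype 𝒳] [Fintype 𝒲] [Fintype 𝒱₀] [Fintype 𝒱₁]
    [DecidableEq 𝒳] [DecidableEq 𝒴]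
    (μ₀ : 𝒳 → ℝ) (ηW : 𝒲 → ℝ) (ν₀ : 𝒱₀ → ℝ) (ν₁ : 𝒱₁ → ℝ)
    (h₀ : 𝒳 → 𝒱₀ → 𝒴) (h₁ : 𝒳 → 𝒱₁ → 𝒴) (f : 𝒳 → 𝒰 → 𝒲 → 𝒳)
    (g : 𝒴 → 𝒰) (y₀ y₁ : 𝒴) : ℝ :=
  ∑ x₀ : 𝒳, ∑ v₀ : 𝒱₀, ∑ w : 𝒲, ∑ v₁ : 𝒱₁,
    if h₀ x₀ v₀ = y₀ ∧ h₁ (f x₀ (g (h₀ x₀ v₀)) w) v₁ = y₁ then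
      μ₀ x₀ * ν₀ v₀ * ηW w * ν₁ v₁
    else 0

/-- The joint closed-loop probability depends on the policy only through its action at `y₀`. -/
theorem jointProb_congr {𝒳 𝒴 𝒰 𝒲 𝒱₀ 𝒱₁ : Type*}
    [Fintype 𝒳] [Fintype 𝒲] [Fintype 𝒱₀] [Fintype 𝒱₁]
    [DecidableEq 𝒳] [DecidableEq 𝒴]
    (μ₀ : 𝒳 → ℝ) (ηW : 𝒲 → ℝ) (ν₀ : 𝒱₀ → ℝ) (ν₁ : 𝒱₁ → ℝ)
    (h₀ : 𝒳 → 𝒱₀ → 𝒴) (h₁ : 𝒳 → 𝒱₁ → 𝒴) (f : 𝒳 → 𝒰 → 𝒲 → 𝒳)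
    {g g' : 𝒴 → 𝒰} {y₀ : 𝒴} (y₁ : 𝒴) (x₁ : 𝒳) (hgg' : g y₀ = g' y₀) :
    jointProb μ₀ ηW ν₀ ν₁ h₀ h₁ f g y₀ y₁ x₁ = jointProb μ₀ ηW ν₀ ν₁ h₀ h₁ f g' y₀ y₁ x₁ := by
  unfold jointProb
  refine sum_congr rfl fun x₀ _ => sum_congr rfl fun v₀ _ => sum_congr rfl fun w _ =>
    sum_congr rfl fun v₁ _ => if_congr (and_congr_right fun h => ?_) rfl rfl
  rw [h, hgg']

/-- The marginal closed-loop probability depends on the policy only through its action at `y₀`. -/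
theorem margProb_congr {𝒳 𝒴 𝒰 𝒲 𝒱₀ 𝒱₁ : Type*}
    [Fintype 𝒳] [Fintype 𝒲] [Fintype 𝒱₀] [Fintype 𝒱₁]
    [DecidableEq 𝒳] [DecidableEq 𝒴]
    (μ₀ : 𝒳 → ℝ) (ηW : 𝒲 → ℝ) (ν₀ : 𝒱₀ → ℝ) (ν₁ : 𝒱₁ → ℝ)
    (h₀ : 𝒳 → 𝒱₀ → 𝒴) (h₁ : 𝒳 → 𝒱₁ → 𝒴) (f : 𝒳 → 𝒰 → 𝒲 → 𝒳)
    {g g' : 𝒴 → 𝒰} {y₀ : 𝒴} (y₁ : 𝒴) (hgg' : g y₀ = g' y₀) :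
    margProb μ₀ ηW ν₀ ν₁ h₀ h₁ f g y₀ y₁ = margProb μ₀ ηW ν₀ ν₁ h₀ h₁ f g' y₀ y₁ := by
  unfold margProb
  refine sum_congr rfl fun x₀ _ => sum_congr rfl fun v₀ _ => sum_congr rfl fun w _ =>
    sum_congr rfl fun v₁ _ => if_congr (and_congr_right fun h => ?_) rfl rfl
  rw [h, hgg']

/-- Policy independence of the information state: the conditional distribution
of the state `X₁` given the observation history `(Y₀, Y₁)` does not depend on
the control policy, provided the two policies agree on the realized
observation `y₀` and the conditioning event has positive probability under
both closed-loop distributions. -/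
theorem informationState_policy_independent
    {𝒳 𝒴 𝒰 𝒲 𝒱₀ 𝒱₁ : Type*}
    [Fintype 𝒳] [Nonempty 𝒳] [Fintype 𝒴] [Nonempty 𝒴] [Fintype 𝒰] [Nonempty 𝒰]
    [Fintype 𝒲] [Nonempty 𝒲] [Fintype 𝒱₀] [Nonempty 𝒱₀] [Fintype 𝒱₁] [Nonempty 𝒱₁]
    [DecidableEq 𝒳] [DecidableEq 𝒴]
    (μ₀ : 𝒳 → ℝ) (hμ₀ : ∀ x, 0 ≤ μ₀ x) (hμ₀1 : ∑ x, μ₀ x = 1)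
    (ηW : 𝒲 → ℝ) (hηW : ∀ w, 0 ≤ ηW w) (hηW1 : ∑ w, ηW w = 1)
    (ν₀ : 𝒱₀ → ℝ) (hν₀ : ∀ v, 0 ≤ ν₀ v) (hν₀1 : ∑ v, ν₀ v = 1)
    (ν₁ : 𝒱₁ → ℝ) (hν₁ : ∀ v, 0 ≤ ν₁ v) (hν₁1 : ∑ v, ν₁ v = 1)
    (h₀ : 𝒳 → 𝒱₀ → 𝒴) (h₁ : 𝒳 → 𝒱₁ → 𝒴) (f : 𝒳 → 𝒰 → 𝒲 → 𝒳)
    (g g' : 𝒴 → 𝒰) (y₀ y₁ : 𝒴) (x₁ : 𝒳)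
    (hgg' : g y₀ = g' y₀)
    (hpos : 0 < margProb μ₀ ηW ν₀ ν₁ h₀ h₁ f g y₀ y₁)
    (hpos' : 0 < margProb μ₀ ηW ν₀ ν₁ h₀ h₁ f g' y₀ y₁) :
    jointProb μ₀ ηW ν₀ ν₁ h₀ h₁ f g y₀ y₁ x₁ /
        margProb μ₀ ηW ν₀ ν₁ h₀ h₁ f g y₀ y₁ =
      jointProb μ₀ ηW ν₀ ν₁ h₀ h₁ f g' y₀ y₁ x₁ /
        margProb μ₀ ηW ν₀ ν₁ h₀ h₁ f g' y₀ y₁ := by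
  rw [jointProb_congr μ₀ ηW ν₀ ν₁ h₀ h₁ f y₁ x₁ hgg',
    margProb_congr μ₀ ηW ν₀ ν₁ h₀ h₁ f y₁ hgg']
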